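/- (Lemma on random matrix sums, counting form.) Let p be a prime, r ≥ 1, n ≥ 1, m ≥ 1, and k_1, …, k_m ≥ 1 with k = k_1 + … + k_m. Let u_i ∈ (ℤ_{p^r})^{k_i} for i ∈ [1:m], and suppose the concatenated vector (u_1, …, u_m) ∈ (ℤ_{p^r})^k has all coordinates in H_s and at least one coordinate not in H_{s+1}, for some 0 ≤ s ≤ r − 1. Then for every x ∈ (ℤ_{p^r})^n, the number of m-tuples (G_1, …, G_m) of matrices G_i ∈ Mat_{k_i × n}(ℤ_{p^r}) satisfying Σ_{i=1}^m u_i G_i = x (vector–matrix products) equals p^{r·k·n − n(r−s)} if every coordinate of x lies in H_s, and equals 0 otherwise. Equivalently, if the entries of all G_i are drawn uniformly and independently from ℤ_{p^r}, then P{Σ_{i=1}^m u_i G_i = x} = p^{−n(r−s)} · 1{x ∈ H_s^n}. -/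

import Mathlib

open scoped Classical

/-- Every nonempty fiber of a homomorphism of groups has the cardinality of the domain divided by
that of the range. -/
theorem AddMonoidHom.card_fiber_mul_card_range {M N : Type*} [AddGroup M] [AddGroup N]
    (f : M →+ N) {x : N} (hx : x ∈ f.range) :
    Nat.card {a | f a = x} * Nat.card f.range = Nat.card M := by
  obtain ⟨a, rfl⟩ := hx
  rw [← AddSubgroup.card_mul_index f.ker, AddSubgroup.index_ker]
  congr 1
  exact Nat.card_congr (f.fiberEquivKer a)

theorem ZMod.mem_zmultiples_iff_exists_mul {N : ℕ} (a x : ZMod N) :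
    x ∈ AddSubgroup.zmultiples a ↔ ∃ y, x = a * y := by
  rw [AddSubgroup.mem_zmultiples_iff]
  constructor
  · rintro ⟨z, rfl⟩
    exact ⟨z, by rw [zsmul_eq_mul, mul_comm]⟩
  · rintro ⟨y, rfl⟩
    obtain ⟨z, rfl⟩ := ZMod.intCast_surjective y
    exact ⟨z, by rw [zsmul_eq_mul, mul_comm]⟩

theorem ZMod.card_zmultiples_prime_pow {p : ℕ} (hp : p.Prime) {r s : ℕ} (hs : s ≤ r) :
    Nat.card (AddSubgroup.zmultiples ((p : ZMod (p ^ r)) ^ s)) = p ^ (r - s) := by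
  rw [Nat.card_zmultiples, ← Nat.cast_pow, ZMod.addOrderOf_coe _ (pow_ne_zero _ hp.ne_zero),
    Nat.gcd_eq_right (pow_dvd_pow p hs), Nat.pow_div hs hp.pos]

theorem ZMod.isUnit_or_exists_eq_prime_mul {p : ℕ} (hp : p.Prime) (r : ℕ) (y : ZMod (p ^ r)) :
    IsUnit y ∨ ∃ z, y = p * z := by
  have : NeZero (p ^ r) := ⟨pow_ne_zero _ hp.ne_zero⟩
  obtain ⟨a, rfl⟩ := ZMod.natCast_zmod_surjective y
  by_cases h : p ∣ a
  · obtain ⟨b, rfl⟩ := h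
    exact Or.inr ⟨b, by push_cast; rfl⟩
  · left
    rw [ZMod.isUnit_iff_coprime]
    exact ((hp.coprime_iff_not_dvd.mpr h).symm).pow_right r

/-- The additive map sending a tuple of matrices `G` to `∑ i, u i ᵥ* G i`. -/
def sumVecMulHom {R : Type*} [CommRing R] {m n : ℕ} {k : Fin m → ℕ}
    (u : ∀ i : Fin m, Fin (k i) → R) :
    (∀ i : Fin m, Matrix (Fin (k i)) (Fin n) R) →+ (Fin n → R) where
  toFun G := ∑ i, Matrix.vecMul (u i) (G i)
  map_zero' := by simp
  map_add' G G' := by simp [Matrix.vecMul_add, Finset.sum_add_distrib]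

/-- If all entries of `u` are multiples of `a`, and one of them is associated to `a`, then the
range of `sumVecMulHom u` consists of the vectors whose coordinates are multiples of `a`. -/
theorem mem_range_sumVecMulHom_iff {R : Type*} [CommRing R] {m n : ℕ} {k : Fin m → ℕ}
    {u : ∀ i : Fin m, Fin (k i) → R} {a : R} (hu : ∀ i j, ∃ y, u i j = a * y)
    {i₀ : Fin m} {j₀ : Fin (k i₀)} {v : Rˣ} (hv : u i₀ j₀ = a * v) (x : Fin n → R) :
    x ∈ (sumVecMulHom u).range ↔ ∀ j, ∃ y, x j = a * y := by
  constructor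
  · rintro ⟨G, rfl⟩ j
    change a ∣ (∑ i, Matrix.vecMul (u i) (G i)) j
    rw [Finset.sum_apply]
    refine Finset.dvd_sum fun i _ => ?_
    rw [Matrix.vecMul, dotProduct]
    exact Finset.dvd_sum fun l _ => Dvd.dvd.mul_right (hu i l) _
  · intro h
    choose y hy using h
    refine ⟨Pi.single i₀ (Matrix.of (Pi.single j₀ fun j => ↑v⁻¹ * y j)), ?_⟩
    change ∑ i, Matrix.vecMul (u i) _ = x
    rw [Finset.sum_eq_single i₀ (fun i _ hi => by simp [Pi.single_eq_of_ne hi]) (by simp)]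
    ext j
    rw [Pi.single_eq_same, Matrix.vecMul, dotProduct,
      Finset.sum_eq_single j₀ (fun l _ hl => by simp [Pi.single_eq_of_ne hl]) (by simp)]
    simp [hv, hy, mul_assoc]

/-- The number of vectors of length `n` over `ZMod (p ^ r)` all of whose coordinates are multiples
of `p ^ s`. -/
theorem ZMod.card_forall_exists_prime_pow_mul {p : ℕ} (hp : p.Prime) {r s : ℕ} (hs : s ≤ r)
    (n : ℕ) :
    Nat.card {x : Fin n → ZMod (p ^ r) // ∀ j, ∃ y, x j = (p : ZMod (p ^ r)) ^ s * y} =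
      p ^ (n * (r - s)) := by
  simp_rw [← ZMod.mem_zmultiples_iff_exists_mul]
  rw [Nat.card_congr Equiv.subtypePiEquivPi, Nat.card_pi]
  simp only [Finset.prod_const, Finset.card_univ, Fintype.card_fin]
  rw [mul_comm n, pow_mul, ← ZMod.card_zmultiples_prime_pow hp hs]

theorem ZMod.card_pi_matrix (N : ℕ) {m : ℕ} (n : ℕ) (k : Fin m → ℕ) :
    Nat.card (∀ i : Fin m, Matrix (Fin (k i)) (Fin n) (ZMod N)) = N ^ ((∑ i, k i) * n) := by
  simp only [Matrix, Nat.card_pi, Nat.card_zmod, Finset.prod_const, Finset.card_univ,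
    Fintype.card_fin]
  rw [Finset.sum_mul, ← Finset.prod_pow_eq_pow_sum]
  exact Finset.prod_congr rfl fun i _ => by rw [mul_comm, pow_mul]

/-- random matrix sums, counting form: Let `p` be prime,
`r, n, m ≥ 1`, `k_1, …, k_m ≥ 1` with `k = Σ k_i`. If the vectors
`u_i ∈ (ℤ_{p^r})^{k_i}` have all coordinates in `H_s` and at least one
coordinate not in `H_{s+1}` (`0 ≤ s ≤ r − 1`), then for every
`x ∈ (ℤ_{p^r})^n`, the number of tuples `(G_1, …, G_m)` of `k_i × n`
matrices over `ℤ_{p^r}` with `Σ_i u_i G_i = x` equals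
`p^(r·k·n − n(r−s))` if every coordinate of `x` lies in `H_s`, and `0`
otherwise. -/
theorem count_matrix_tuples_vecMul_sum_eq
    (p : ℕ) (hp : p.Prime) (r n m : ℕ) (hr : 1 ≤ r) (hn : 1 ≤ n) (hm : 1 ≤ m)
    (k : Fin m → ℕ) (hk : ∀ i, 1 ≤ k i) (s : ℕ) (hs : s ≤ r - 1)
    (u : ∀ i : Fin m, Fin (k i) → ZMod (p ^ r))
    (hu1 : ∀ i j, ∃ y : ZMod (p ^ r), u i j = (p : ZMod (p ^ r)) ^ s * y)
    (hu2 : ¬ ∀ i j, ∃ y : ZMod (p ^ r), u i j = (p : ZMod (p ^ r)) ^ (s + 1) * y)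
    (x : Fin n → ZMod (p ^ r)) :
    Nat.card {G : ∀ i : Fin m, Matrix (Fin (k i)) (Fin n) (ZMod (p ^ r)) |
        ∑ i, Matrix.vecMul (u i) (G i) = x} =
      if ∀ j, ∃ y : ZMod (p ^ r), x j = (p : ZMod (p ^ r)) ^ s * y then
        p ^ (r * (∑ i, k i) * n - n * (r - s))
      else 0 := by
  have hsr : s ≤ r := by omega
  push Not at hu2
  obtain ⟨i₀, j₀, h₀⟩ := hu2
  obtain ⟨v, hv⟩ : ∃ v : (ZMod (p ^ r))ˣ, u i₀ j₀ = (p : ZMod (p ^ r)) ^ s * v := by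
    obtain ⟨y, hy⟩ := hu1 i₀ j₀
    rcases ZMod.isUnit_or_exists_eq_prime_mul hp r y with ⟨v, rfl⟩ | ⟨z, rfl⟩
    · exact ⟨v, hy⟩
    · exact absurd (by rw [hy, pow_succ, mul_assoc]) (h₀ z)
  have hrange := mem_range_sumVecMulHom_iff (n := n) hu1 hv
  split_ifs with hx
  · have hcard := (sumVecMulHom u).card_fiber_mul_card_range ((hrange x).mpr hx)
    rw [Nat.card_congr (Equiv.subtypeEquivRight hrange),
      ZMod.card_forall_exists_prime_pow_mul hp hsr, ZMod.card_pi_matrix, ← pow_mul] at hcard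
    have hk₀ : 1 ≤ ∑ i, k i :=
      (hk i₀).trans (Finset.single_le_sum (fun _ _ => Nat.zero_le _) (Finset.mem_univ i₀))
    have hle : n * (r - s) ≤ r * (∑ i, k i) * n := by
      rw [mul_comm n]
      exact Nat.mul_le_mul_right n ((Nat.sub_le r s).trans (Nat.le_mul_of_pos_right r hk₀))
    refine Nat.eq_of_mul_eq_mul_right (pow_pos hp.pos (n * (r - s))) ?_
    rw [← pow_add, Nat.sub_add_cancel hle, mul_assoc r]
    exact hcard
  · rw [Nat.card_eq_zero]
    exact Or.inl ⟨fun G => hx ((hrange x).mp ⟨G.1, G.2⟩)⟩
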